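/- arXiv:1810.02003 — 2 statements merged into one kernel-verified Lean document; each statement's English description precedes it below -/
import Mathlib

section
/- Let Ŝ be a groupwise calibrated soft classifier whose accuracy profile is nice (all groups' score supports are equal). Let D̂_{(τ,R)} be a group-blind threshold post-processor with τ(g) = min(Supp(𝒫_g)) and R(g) < 1 for every group g. Then the composed hard classifier Ŷ = D̂_{(τ,R)}∘Ŝ equalizes NPV across all groups g on which Ŷ is non-trivial: for any two such groups g, g', NPV_{Ŷ,g} = NPV_{Ŷ,g'}. -/
open Finset
open scoped Classical

namespace GroupFairness

noncomputable section

variable {X 𝒢 Ω : Type*} [Fintype X] [Fintype Ω]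

/-- The finset of members of group `g`. -/
def grp (Grp : X → 𝒢) (g : 𝒢) : Finset X :=
  Finset.univ.filter (fun x => Grp x = g)

/-- Expectation of `f x ω` over a uniformly random member `x` of group `g`,
together with internal randomness `ω` distributed according to the weights `w`. -/
def Ex (w : Ω → ℝ) (Grp : X → 𝒢) (g : 𝒢) (f : X → Ω → ℝ) : ℝ :=
  (∑ x ∈ grp Grp g, ∑ ω : Ω, w ω * f x ω) / ((grp Grp g).card : ℝ)

/-- Probability of the event `E x ω` for a uniformly random member of group `g`. -/
def Pr (w : Ω → ℝ) (Grp : X → 𝒢) (g : 𝒢) (E : X → Ω → Prop) : ℝ :=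
  Ex w Grp g (fun x ω => if E x ω then 1 else 0)

/-- Conditional probability of `E` given `F`. -/
def cPr (w : Ω → ℝ) (Grp : X → 𝒢) (g : 𝒢) (E F : X → Ω → Prop) : ℝ :=
  Pr w Grp g (fun x ω => E x ω ∧ F x ω) / Pr w Grp g F

/-- `w` is a probability weighting on the randomness space. -/
def ValidWeights (w : Ω → ℝ) : Prop :=
  (∀ ω, 0 ≤ w ω) ∧ ∑ ω : Ω, w ω = 1

/-- The base rate of group `g`: the probability that a uniformly random member
of `g` has true type `1`. -/
def BaseRate (w : Ω → ℝ) (Grp : X → 𝒢) (Y : X → Bool) (g : 𝒢) : ℝ :=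
  Pr w Grp g (fun x _ => Y x = true)

/-- All scores of the soft classifier lie in `[0,1]`. -/
def IsSoft (S : X → Ω → ℝ) : Prop :=
  ∀ x ω, 0 ≤ S x ω ∧ S x ω ≤ 1

/-- `S` is groupwise calibrated: for every group `g` and score `s` occurring with
positive probability, `Pr[Y = 1 ∣ S = s] = s`. -/
def Calibrated (w : Ω → ℝ) (Grp : X → 𝒢) (Y : X → Bool) (S : X → Ω → ℝ) : Prop :=
  ∀ (g : 𝒢) (s : ℝ), 0 < Pr w Grp g (fun x ω => S x ω = s) →
    cPr w Grp g (fun x _ => Y x = true) (fun x ω => S x ω = s) = s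

/-- The accuracy profile of `S` on group `g`: the pmf of the score `S(X_g)`. -/
def AP (w : Ω → ℝ) (Grp : X → 𝒢) (S : X → Ω → ℝ) (g : 𝒢) (s : ℝ) : ℝ :=
  Pr w Grp g (fun x ω => S x ω = s)

/-- The support of the accuracy profile of `S` on group `g`. -/
def APsupp (w : Ω → ℝ) (Grp : X → 𝒢) (S : X → Ω → ℝ) (g : 𝒢) : Set ℝ :=
  {s | 0 < AP w Grp S g s}

/-- The accuracy profile is *nice*: all groups have the same support. -/
def NiceAP (w : Ω → ℝ) (Grp : X → 𝒢) (S : X → Ω → ℝ) : Prop :=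
  ∀ g g' : 𝒢, APsupp w Grp S g = APsupp w Grp S g'

/-- A (randomized) hard post-processor is described by the probability `q s g` of
outputting `1` on score `s` and group `g`; it is valid if these are probabilities. -/
def ValidPP (q : ℝ → 𝒢 → ℝ) : Prop :=
  ∀ (s : ℝ) (g : 𝒢), 0 ≤ q s g ∧ q s g ≤ 1

/-- Probability that the composed hard classifier `D̂ ∘ Ŝ` outputs `1` on group `g`. -/
def prPos (w : Ω → ℝ) (Grp : X → 𝒢) (S : X → Ω → ℝ) (q : ℝ → 𝒢 → ℝ) (g : 𝒢) : ℝ :=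
  Ex w Grp g (fun x ω => q (S x ω) (Grp x))

/-- Probability that the composed hard classifier `D̂ ∘ Ŝ` outputs `0` on group `g`. -/
def prNeg (w : Ω → ℝ) (Grp : X → 𝒢) (S : X → Ω → ℝ) (q : ℝ → 𝒢 → ℝ) (g : 𝒢) : ℝ :=
  Ex w Grp g (fun x ω => 1 - q (S x ω) (Grp x))

/-- The composed hard classifier is non-trivial on `g`. -/
def NonTrivial (w : Ω → ℝ) (Grp : X → 𝒢) (S : X → Ω → ℝ) (q : ℝ → 𝒢 → ℝ) (g : 𝒢) : Prop :=
  0 < prPos w Grp S q g ∧ 0 < prNeg w Grp S q g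

/-- Positive predictive value `Pr[Y = 1 ∣ Ŷ = 1]` of the composed classifier on `g`. -/
def PPV (w : Ω → ℝ) (Grp : X → 𝒢) (Y : X → Bool) (S : X → Ω → ℝ)
    (q : ℝ → 𝒢 → ℝ) (g : 𝒢) : ℝ :=
  Ex w Grp g (fun x ω => (if Y x then 1 else 0) * q (S x ω) (Grp x)) / prPos w Grp S q g

/-- Negative predictive value `Pr[Y = 0 ∣ Ŷ = 0]` of the composed classifier on `g`. -/
def NPV (w : Ω → ℝ) (Grp : X → 𝒢) (Y : X → Bool) (S : X → Ω → ℝ)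
    (q : ℝ → 𝒢 → ℝ) (g : 𝒢) : ℝ :=
  Ex w Grp g (fun x ω => (if Y x then 0 else 1) * (1 - q (S x ω) (Grp x))) / prNeg w Grp S q g

/-- False positive rate `Pr[Ŷ = 1 ∣ Y = 0]` of the composed classifier on `g`. -/
def FPR (w : Ω → ℝ) (Grp : X → 𝒢) (Y : X → Bool) (S : X → Ω → ℝ)
    (q : ℝ → 𝒢 → ℝ) (g : 𝒢) : ℝ :=
  Ex w Grp g (fun x ω => (if Y x then 0 else 1) * q (S x ω) (Grp x)) /
    Pr w Grp g (fun x _ => Y x = false)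

/-- False negative rate `Pr[Ŷ = 0 ∣ Y = 1]` of the composed classifier on `g`. -/
def FNR (w : Ω → ℝ) (Grp : X → 𝒢) (Y : X → Bool) (S : X → Ω → ℝ)
    (q : ℝ → 𝒢 → ℝ) (g : 𝒢) : ℝ :=
  Ex w Grp g (fun x ω => (if Y x then 1 else 0) * (1 - q (S x ω) (Grp x))) /
    Pr w Grp g (fun x _ => Y x = true)

/-- The threshold post-processor with threshold `τ g` and on-threshold probability
`R g` for group `g`: it outputs `1` with probability `1` above the threshold, `0`
below it, and `1` with probability `R g` at the threshold. -/
def thresholdPP (τ R : 𝒢 → ℝ) : ℝ → 𝒢 → ℝ := fun s g =>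
  if τ g < s then 1 else if s = τ g then R g else 0

theorem Ex_congr {w : Ω → ℝ} {Grp : X → 𝒢} {g : 𝒢} {f f' : X → Ω → ℝ}
    (h : ∀ x ∈ grp Grp g, ∀ ω, w ω ≠ 0 → f x ω = f' x ω) :
    Ex w Grp g f = Ex w Grp g f' := by
  unfold Ex
  congr 1
  refine Finset.sum_congr rfl fun x hx => Finset.sum_congr rfl fun ω _ => ?_
  by_cases hω : w ω = 0
  · simp [hω]
  · rw [h x hx ω hω]

theorem Ex_const_mul (w : Ω → ℝ) (Grp : X → 𝒢) (g : 𝒢) (c : ℝ) (f : X → Ω → ℝ) :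
    Ex w Grp g (fun x ω => c * f x ω) = c * Ex w Grp g f := by
  simp only [Ex, mul_left_comm _ c, ← Finset.mul_sum, mul_div_assoc]

theorem Ex_sub (w : Ω → ℝ) (Grp : X → 𝒢) (g : 𝒢) (f f' : X → Ω → ℝ) :
    Ex w Grp g (fun x ω => f x ω - f' x ω) = Ex w Grp g f - Ex w Grp g f' := by
  simp only [Ex, mul_sub, Finset.sum_sub_distrib, sub_div]

/-- A score attained on a member of `g` under randomness of positive weight lies in the support
of the accuracy profile of `g`. -/
theorem score_mem_APsupp {w : Ω → ℝ} (hw : ∀ ω, 0 ≤ w ω) {Grp : X → 𝒢} (S : X → Ω → ℝ)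
    {g : 𝒢} {x : X} (hx : x ∈ grp Grp g) {ω : Ω} (hω : w ω ≠ 0) :
    S x ω ∈ APsupp w Grp S g := by
  have hnonneg : ∀ y ω', 0 ≤ w ω' * (if S y ω' = S x ω then (1 : ℝ) else 0) := fun y ω' =>
    mul_nonneg (hw ω') (by split_ifs <;> norm_num)
  refine div_pos (Finset.sum_pos' (fun y _ => Finset.sum_nonneg fun ω' _ => hnonneg y ω')
    ⟨x, hx, Finset.sum_pos' (fun ω' _ => hnonneg x ω') ⟨ω, Finset.mem_univ ω, ?_⟩⟩) ?_
  · simpa using lt_of_le_of_ne (hw ω) hω.symm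
  · exact_mod_cast Finset.card_pos.mpr ⟨x, hx⟩

/-- Thresholding a groupwise calibrated soft classifier at the minimum `t` of its support on `g`,
with on-threshold probability less than `1`, gives NPV `1 - t` on `g`. -/
theorem NPV_thresholdPP_min {w : Ω → ℝ} (hw : ∀ ω, 0 ≤ w ω) {Grp : X → 𝒢} {Y : X → Bool}
    {S : X → Ω → ℝ} (hcal : Calibrated w Grp Y S) {t r : ℝ} (hr : r < 1) {g : 𝒢}
    (ht : t ∈ APsupp w Grp S g) (hle : ∀ s ∈ APsupp w Grp S g, t ≤ s) :
    NPV w Grp Y S (thresholdPP (fun _ => t) (fun _ => r)) g = 1 - t := by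
  have hneg : ∀ x ∈ grp Grp g, ∀ ω, w ω ≠ 0 →
      1 - thresholdPP (fun _ : 𝒢 => t) (fun _ => r) (S x ω) (Grp x) =
        (1 - r) * (if S x ω = t then 1 else 0) := by
    intro x hx ω hω
    rcases (hle _ (score_mem_APsupp hw S hx hω)).eq_or_lt with h | h
    · simp [thresholdPP, ← h]
    · simp [thresholdPP, h, h.ne']
  have hden : prNeg w Grp S (thresholdPP (fun _ => t) (fun _ => r)) g =
      (1 - r) * Pr w Grp g (fun x ω => S x ω = t) := by
    rw [prNeg, Ex_congr hneg, Ex_const_mul, Pr]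
  have hnum : Ex w Grp g (fun x ω => (if Y x then 0 else 1) *
        (1 - thresholdPP (fun _ => t) (fun _ => r) (S x ω) (Grp x))) =
      (1 - r) * (Pr w Grp g (fun x ω => S x ω = t) -
        Pr w Grp g (fun x ω => Y x = true ∧ S x ω = t)) := by
    rw [Pr, Pr, ← Ex_sub, ← Ex_const_mul]
    refine Ex_congr fun x hx ω hω => ?_
    rw [hneg x hx ω hω]
    by_cases hY : Y x = true <;> simp [hY]
  have hpos : 0 < Pr w Grp g (fun x ω => S x ω = t) := ht
  have hjoint := hcal g t hpos
  rw [cPr, div_eq_iff hpos.ne'] at hjoint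
  have hr' : 1 - r ≠ 0 := (sub_pos.mpr hr).ne'
  rw [NPV, hnum, hden, hjoint]
  field_simp

/-- For a nice, groupwise calibrated soft classifier, the group-blind
threshold post-processor whose threshold is the minimum of the (common) support and
whose on-threshold probability is `< 1` equalizes NPV across all groups on which the
composed classifier is non-trivial. -/
theorem groupBlind_minThreshold_equalizes_NPV
    (w : Ω → ℝ) (Grp : X → 𝒢) (Y : X → Bool) (S : X → Ω → ℝ) (t r : ℝ)
    (hw : ValidWeights w) (hne : ∀ g : 𝒢, (grp Grp g).Nonempty)
    (hS : IsSoft S) (hcal : Calibrated w Grp Y S) (hnice : NiceAP w Grp S)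
    (hr0 : 0 ≤ r) (hr1 : r < 1)
    (hmin : ∀ g : 𝒢, t ∈ APsupp w Grp S g ∧ ∀ s ∈ APsupp w Grp S g, t ≤ s)
    (g g' : 𝒢)
    (hg : NonTrivial w Grp S (thresholdPP (fun _ => t) (fun _ => r)) g)
    (hg' : NonTrivial w Grp S (thresholdPP (fun _ => t) (fun _ => r)) g') :
    NPV w Grp Y S (thresholdPP (fun _ => t) (fun _ => r)) g =
      NPV w Grp Y S (thresholdPP (fun _ => t) (fun _ => r)) g' := by
  rw [NPV_thresholdPP_min hw.1 hcal hr1 (hmin g).1 (hmin g).2,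
    NPV_thresholdPP_min hw.1 hcal hr1 (hmin g').1 (hmin g').2]

end

end GroupFairness
end

section
/- Let Ŝ be a groupwise calibrated soft classifier, g₁, g₂ two groups, and D̂_{(τ,R)} a group-blind threshold post-processor such that Ŷ = D̂_{(τ,R)}∘Ŝ is non-trivial on both groups. For i = 1, 2, let 𝒫_{g_i,(τ,R)} be the distribution of Ŝ(X_{g_i}) conditioned on D̂_{(τ,R)}(Ŝ(X_{g_i}), g_i) = 1. If 𝒫_{g₂,(τ,R)} strictly first-order stochastically dominates 𝒫_{g₁,(τ,R)}, then PPV_{Ŷ,g₁} < PPV_{Ŷ,g₂}. -/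
open Finset
open scoped Classical

namespace GroupFairness

noncomputable section

variable {X 𝒢 Ω : Type*} [Fintype X] [Fintype Ω]

/-- The conditional pmf-tail `Pr[Ŝ(X_g) ≥ t ∣ Ŷ(X_g) = 1]` of the score distribution
conditioned on the composed classifier outputting `1`. -/
def condTailPos (w : Ω → ℝ) (Grp : X → 𝒢) (S : X → Ω → ℝ) (q : ℝ → 𝒢 → ℝ)
    (g : 𝒢) (t : ℝ) : ℝ :=
  Ex w Grp g (fun x ω => (if t ≤ S x ω then 1 else 0) * q (S x ω) (Grp x)) /
    prPos w Grp S q g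

/-- The finite set of scores taken by `S`. -/
def scores (S : X → Ω → ℝ) : Finset ℝ :=
  Finset.univ.image (fun p : X × Ω => S p.1 p.2)

theorem Ex_mul_comp (w : Ω → ℝ) (Grp : X → 𝒢) (g : 𝒢) (S : X → Ω → ℝ)
    (f : X → Ω → ℝ) (Q : ℝ → ℝ) :
    Ex w Grp g (fun x ω => f x ω * Q (S x ω)) =
      ∑ s ∈ scores S, Q s * Ex w Grp g (fun x ω => f x ω * if S x ω = s then 1 else 0) := by
  simp only [Ex, mul_div_assoc', ← Finset.sum_div, Finset.mul_sum]
  congr 1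
  conv_rhs => rw [Finset.sum_comm]
  refine Finset.sum_congr rfl fun x _ => ?_
  conv_rhs => rw [Finset.sum_comm]
  refine Finset.sum_congr rfl fun ω _ => ?_
  have hmem : S x ω ∈ scores S := Finset.mem_image.2 ⟨(x, ω), Finset.mem_univ _, rfl⟩
  rw [Finset.sum_eq_single_of_mem _ hmem fun s _ hs => by simp [hs.symm]]
  simp only [if_true]
  ring

theorem Ex_mono (w : Ω → ℝ) (hw : ∀ ω, 0 ≤ w ω) (Grp : X → 𝒢) (g : 𝒢) {f h : X → Ω → ℝ}
    (hfh : ∀ x ω, f x ω ≤ h x ω) : Ex w Grp g f ≤ Ex w Grp g h := by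
  unfold Ex
  gcongr with x _ ω _
  · exact hw ω
  · exact hfh x ω

theorem Pr_nonneg (w : Ω → ℝ) (hw : ∀ ω, 0 ≤ w ω) (Grp : X → 𝒢) (g : 𝒢)
    (E : X → Ω → Prop) : 0 ≤ Pr w Grp g E := by
  have h := Ex_mono w hw Grp g (f := fun _ _ => 0) (h := fun x ω => if E x ω then 1 else 0)
    fun x ω => by split_ifs <;> norm_num
  simpa [Ex, Pr] using h

/-- Calibration in product form, valid also for scores of probability zero. -/
theorem Calibrated.Ex_eq {w : Ω → ℝ} (hw : ∀ ω, 0 ≤ w ω) {Grp : X → 𝒢} {Y : X → Bool}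
    {S : X → Ω → ℝ} (hcal : Calibrated w Grp Y S) (g : 𝒢) (s : ℝ) :
    Ex w Grp g (fun x ω => (if Y x then 1 else 0) * if S x ω = s then 1 else 0) =
      s * AP w Grp S g s := by
  have hE : Ex w Grp g (fun x ω => (if Y x then 1 else 0) * if S x ω = s then 1 else 0) =
      Pr w Grp g (fun x ω => Y x = true ∧ S x ω = s) := by
    unfold Pr
    congr 1
    funext x ω
    by_cases h : Y x = true <;> simp [h]
  have hle : Pr w Grp g (fun x ω => Y x = true ∧ S x ω = s) ≤ AP w Grp S g s :=
    Ex_mono w hw Grp g fun x ω => by by_cases h : Y x = true <;> by_cases S x ω = s <;> simp [*]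
  have hge : 0 ≤ Pr w Grp g (fun x ω => Y x = true ∧ S x ω = s) :=
    Pr_nonneg w hw Grp g _
  rw [hE]
  rcases (Pr_nonneg w hw Grp g fun x ω => S x ω = s).eq_or_lt with h0 | hpos
  · change 0 = AP w Grp S g s at h0
    rw [← h0] at hle ⊢
    rw [mul_zero]
    exact le_antisymm hle hge
  · exact (div_eq_iff hpos.ne').1 (hcal g s hpos)

/-- Summation by parts: the weighted sum is nonnegative if all tails are, and positive if
moreover some tail is. -/
theorem sum_mul_sub_of_tail_nonneg (d : ℝ → ℝ) (V : Finset ℝ) :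
    ∀ c : ℝ, (∀ s ∈ V, c < s) → (∀ u : ℝ, 0 ≤ ∑ s ∈ V, (if u ≤ s then 1 else 0) * d s) →
      0 ≤ ∑ s ∈ V, (s - c) * d s ∧
      ((∃ u : ℝ, 0 < ∑ s ∈ V, (if u ≤ s then 1 else 0) * d s) →
        0 < ∑ s ∈ V, (s - c) * d s) := by
  induction V using Finset.induction_on_min with
  | empty => simp
  | insert a V ha ih =>
    intro c hc hnn
    have haV : a ∉ V := fun h => lt_irrefl a (ha a h)
    have hca : 0 < a - c := sub_pos.2 (hc a (Finset.mem_insert_self a V))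
    have hlow : ∀ u ≤ a, ∑ s ∈ insert a V, (if u ≤ s then 1 else 0) * d s =
        ∑ s ∈ insert a V, d s := fun u hu =>
      Finset.sum_congr rfl fun s hs => by
        have hus : u ≤ s := by
          rcases Finset.mem_insert.1 hs with rfl | h
          · exact hu
          · exact hu.trans (ha s h).le
        simp [hus]
    have hhigh : ∀ u, a < u → ∑ s ∈ insert a V, (if u ≤ s then 1 else 0) * d s =
        ∑ s ∈ V, (if u ≤ s then 1 else 0) * d s := fun u hu => by
      rw [Finset.sum_insert haV, if_neg hu.not_ge, zero_mul, zero_add]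
    have hsplit : ∑ s ∈ insert a V, (s - c) * d s =
        ∑ s ∈ V, (s - a) * d s + (a - c) * ∑ s ∈ insert a V, d s := by
      rw [Finset.mul_sum, Finset.sum_insert haV, Finset.sum_insert haV, add_left_comm,
        ← Finset.sum_add_distrib]
      congr 1
      exact Finset.sum_congr rfl fun s _ => by ring
    have htot : 0 ≤ ∑ s ∈ insert a V, d s := hlow a le_rfl ▸ hnn a
    have htail : ∀ u, 0 ≤ ∑ s ∈ V, (if u ≤ s then 1 else 0) * d s := by
      intro u
      rcases lt_or_ge a u with hu | hu
      · exact hhigh u hu ▸ hnn u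
      · rcases V.eq_empty_or_nonempty with rfl | hV
        · simp
        · have hm := ha _ (V.min'_mem hV)
          have h := hhigh _ hm ▸ hnn (V.min' hV)
          refine h.trans_eq (Finset.sum_congr rfl fun s hs => ?_)
          rw [if_pos (V.min'_le s hs), if_pos (hu.trans (ha s hs).le)]
    rw [hsplit]
    obtain ⟨ih_nonneg, ih_pos⟩ := ih a ha htail
    refine ⟨add_nonneg ih_nonneg (mul_nonneg hca.le htot), fun ⟨u, hu⟩ => ?_⟩
    rcases lt_or_ge a u with hau | hua
    · exact add_pos_of_pos_of_nonneg (ih_pos ⟨u, hhigh u hau ▸ hu⟩) (mul_nonneg hca.le htot)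
    · exact add_pos_of_nonneg_of_pos ih_nonneg (mul_pos hca (hlow u hua ▸ hu))

/-- If, for a group-blind threshold post-processor, the conditional
score distribution of group `g₂` (conditioned on predicting `1`) strictly first-order
stochastically dominates that of group `g₁`, then `PPV_{g₁} < PPV_{g₂}`. -/
theorem PPV_lt_of_strict_stochastic_dominance
    (w : Ω → ℝ) (Grp : X → 𝒢) (Y : X → Bool) (S : X → Ω → ℝ) (t r : ℝ) (g₁ g₂ : 𝒢)
    (hw : ValidWeights w) (hne : ∀ g : 𝒢, (grp Grp g).Nonempty)
    (hS : IsSoft S) (hcal : Calibrated w Grp Y S)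
    (hr0 : 0 ≤ r) (hr1 : r ≤ 1)
    (hnt₁ : NonTrivial w Grp S (thresholdPP (fun _ => t) (fun _ => r)) g₁)
    (hnt₂ : NonTrivial w Grp S (thresholdPP (fun _ => t) (fun _ => r)) g₂)
    (hdom : ∀ u : ℝ,
      condTailPos w Grp S (thresholdPP (fun _ => t) (fun _ => r)) g₁ u ≤
        condTailPos w Grp S (thresholdPP (fun _ => t) (fun _ => r)) g₂ u)
    (hstrict : ∃ u : ℝ,
      condTailPos w Grp S (thresholdPP (fun _ => t) (fun _ => r)) g₁ u <
        condTailPos w Grp S (thresholdPP (fun _ => t) (fun _ => r)) g₂ u) :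
    PPV w Grp Y S (thresholdPP (fun _ => t) (fun _ => r)) g₁ <
      PPV w Grp Y S (thresholdPP (fun _ => t) (fun _ => r)) g₂ := by
  set Q : ℝ → ℝ := fun s => thresholdPP (fun _ : 𝒢 => t) (fun _ => r) s g₁ with hQ
  set P : 𝒢 → ℝ := prPos w Grp S (thresholdPP (fun _ => t) (fun _ => r)) with hP
  set p : 𝒢 → ℝ → ℝ := fun g s => Q s * AP w Grp S g s / P g with hp
  have hPsum : ∀ g, P g = ∑ s ∈ scores S, Q s * AP w Grp S g s := fun g => by
    have h := Ex_mul_comp w Grp g S (fun _ _ => 1) Q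
    simp only [one_mul] at h
    exact h
  have hone : ∀ g, 0 < P g → ∑ s ∈ scores S, p g s = 1 := fun g hg => by
    rw [hp, ← Finset.sum_div, ← hPsum, div_self hg.ne']
  have hPPV : ∀ g, PPV w Grp Y S (thresholdPP (fun _ => t) (fun _ => r)) g =
      ∑ s ∈ scores S, s * p g s := fun g => by
    have h := Ex_mul_comp w Grp g S (fun x _ => if Y x then 1 else 0) Q
    simp only [hcal.Ex_eq hw.1] at h
    refine (congrArg (· / P g) h).trans ?_
    simp only [Finset.sum_div, hp]
    exact Finset.sum_congr rfl fun s _ => by ring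
  have htail : ∀ g u, condTailPos w Grp S (thresholdPP (fun _ => t) (fun _ => r)) g u =
      ∑ s ∈ scores S, (if u ≤ s then 1 else 0) * p g s := fun g u => by
    have h := Ex_mul_comp w Grp g S (fun _ _ => 1) (fun s => (if u ≤ s then 1 else 0) * Q s)
    simp only [one_mul] at h
    refine (congrArg (· / P g) h).trans ?_
    simp only [Finset.sum_div, hp]
    exact Finset.sum_congr rfl fun s _ => by unfold AP Pr; ring
  have hlow : ∀ s ∈ scores S, -1 < s := fun s hs => by
    obtain ⟨⟨x, ω⟩, -, rfl⟩ := Finset.mem_image.1 hs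
    linarith [(hS x ω).1]
  have key := (sum_mul_sub_of_tail_nonneg (fun s => p g₂ s - p g₁ s) (scores S) (-1) hlow
    (fun u => by
      simpa only [mul_sub, Finset.sum_sub_distrib, ← htail, sub_nonneg] using hdom u)).2
    (by simpa only [mul_sub, Finset.sum_sub_distrib, ← htail, sub_pos] using hstrict)
  simp only [sub_neg_eq_add, add_mul, one_mul, mul_sub, Finset.sum_add_distrib,
    Finset.sum_sub_distrib, hone g₁ hnt₁.1, hone g₂ hnt₂.1, ← hPPV] at key
  linarith

end

end GroupFairness
end
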